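/- Let G be a finitely generated virtually abelian group, and let A ≅ ℤ^k be a finite index normal subgroup of G. Equip A with its standard generating set {a₁, …, a_k} and standard normal form η_A(x₁, …, x_k) = a₁^{x₁}⋯a_k^{x_k}, fix a right transversal T of A in G, and let η be the inherited normal form for (G, {a₁, …, a_k} ⊔ T) given by η(g) = η_A(h_g) t_g, where g = h_g t_g with h_g ∈ A and t_g ∈ T is the unique factorisation. Then η is regular and quasigeodesic, and the solution language, with respect to η, of any finite system of equations with rational constraints in G is EDT0L. -/

import Mathlib

namespace Paper

/-- Apply a letterwise substitution (i.e. the endomorphism of the free monoid `C*`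
determined by its action on letters) to a word over `C`. -/
def subApply {C : Type*} (f : C → List C) (w : List C) : List C := (w.map f).flatten

/-- An EDT0L system: a finite extended alphabet `C`, an identification of some letters of
`C` with terminal letters of the alphabet `α` (injectively, modelling `Σ ⊆ C`), a start
word over `C`, and a rational control: a regular language over a finite set of letterwise
substitutions (endomorphisms of `C*`), a word of endomorphisms acting by composition. -/
structure EDT0LSystem (α : Type*) where
  C : Type
  finC : Fintype C
  term : C → Option α
  term_inj : ∀ c c' a, term c = some a → term c' = some a → c = c'
  start : List C
  ι : Type
  finι : Fintype ι
  tab : ι → C → List C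
  control : Language ι
  control_reg : control.IsRegular

/-- The endomorphism of `C*` given by a word of basic endomorphisms, applied to `w`
(the word `φ₁φ₂⋯φₖ` acts as `φ₁∘φ₂∘⋯∘φₖ`, functions written on the right). -/
def EDT0LSystem.apply {α : Type*} (S : EDT0LSystem α) (φs : List S.ι) (w : List S.C) :
    List S.C :=
  φs.foldl (fun v i => subApply (S.tab i) v) w

/-- The language accepted by an EDT0L system: `{ωφ : φ ∈ R} ∩ Σ*`. -/
def EDT0LSystem.accepts {α : Type*} (S : EDT0LSystem α) : Language α :=
  { w | ∃ φs ∈ S.control, (S.apply φs S.start).map S.term = w.map Option.some }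

/-- A language is EDT0L if it is accepted by some EDT0L system. -/
def IsEDT0L {α : Type*} (L : Language α) : Prop := ∃ S : EDT0LSystem α, S.accepts = L

/-- Evaluate a word over the alphabet `Σ ∪ Σ⁻¹` (a letter is a generator index together
with a sign) in a group. -/
def evalWord {G : Type*} [Group G] {ι : Type*} (gen : ι → G) (w : List (ι × Bool)) : G :=
  (w.map fun l => if l.2 then gen l.1 else (gen l.1)⁻¹).prod

/-- The word length of `g` with respect to the generating set `gen`. -/
noncomputable def wordLength {G : Type*} [Group G] {ι : Type*} (gen : ι → G) (g : G) : ℕ :=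
  sInf {n | ∃ w : List (ι × Bool), evalWord gen w = g ∧ w.length = n}

/-- A normal form is quasigeodesic if `|η(g)| ≤ λ·|g| + λ` for some `λ > 0`. -/
def IsQuasigeodesicNF {G : Type*} [Group G] {ι : Type*} (gen : ι → G)
    (η : G → List (ι × Bool)) : Prop :=
  ∃ lam : ℝ, 0 < lam ∧ ∀ g : G, ((η g).length : ℝ) ≤ lam * (wordLength gen g) + lam

/-- A normal form is regular if its image is a regular language. -/
def IsRegularNF {G : Type*} [Group G] {ι : Type*} (η : G → List (ι × Bool)) : Prop :=
  Language.IsRegular (Set.range η : Language (ι × Bool))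

/-- A subset of a group is rational if it is the image of a regular language under the
evaluation map from the free monoid on a finite monoid generating set. -/
def IsRationalSubset {G : Type*} [Group G] (A : Set G) : Prop :=
  ∃ (ι : Type) (_ : Fintype ι) (gen : ι → G) (L : Language ι),
    Submonoid.closure (Set.range gen) = ⊤ ∧ L.IsRegular ∧
      A = (fun w : List ι => (w.map gen).prod) '' L

/-- A subset of a group is recognisable if its full preimage under the evaluation map
from the free monoid on a finite monoid generating set is a regular language. -/
def IsRecognisableSubset {G : Type*} [Group G] (A : Set G) : Prop :=
  ∃ (ι : Type) (_ : Fintype ι) (gen : ι → G),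
    Submonoid.closure (Set.range gen) = ⊤ ∧
      Language.IsRegular ({w : List ι | (w.map gen).prod ∈ A} : Language ι)

/-- The word `w₁ # w₂ # ⋯ # wₘ` over `β ⊕ {#}`. -/
def hashWord {β : Type*} {m : ℕ} (ws : Fin m → List β) : List (β ⊕ Unit) :=
  List.intercalate [Sum.inr ()] (List.ofFn fun i => (ws i).map Sum.inl)

/-- `g : Fin m → G` is a solution of the system `E ⊆ G ∗ F_X` of equations. -/
def SolvesSystem {G : Type*} [Group G] {m : ℕ}
    (E : Set (Monoid.Coprod G (FreeGroup (Fin m)))) (g : Fin m → G) : Prop :=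
  ∀ e ∈ E, Monoid.Coprod.lift (MonoidHom.id G) (FreeGroup.lift g) e = 1

/-- The solution language of a system of equations with constraints, w.r.t. a normal form. -/
def solutionLanguageC {G : Type*} [Group G] {ι : Type*} (η : G → List (ι × Bool)) {m : ℕ}
    (E : Set (Monoid.Coprod G (FreeGroup (Fin m)))) (Rc : Fin m → Set G) :
    Language ((ι × Bool) ⊕ Unit) :=
  { w | ∃ g : Fin m → G, SolvesSystem E g ∧ (∀ i, g i ∈ Rc i) ∧
      w = hashWord fun i => η (g i) }

/-- The solution language of a system of equations, w.r.t. a normal form. -/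
def solutionLanguage {G : Type*} [Group G] {ι : Type*} (η : G → List (ι × Bool)) {m : ℕ}
    (E : Set (Monoid.Coprod G (FreeGroup (Fin m)))) : Language ((ι × Bool) ⊕ Unit) :=
  solutionLanguageC η E fun _ => Set.univ

/-- Evaluate a twisted word (a word over `H ∪ (F_X × Ω)`) at the assignment `g` of the
variables: each letter `(u, ψ)` becomes `ψ(uφ)` where `φ` is the homomorphism `F_X → H`
determined by `g`, and the word is multiplied out in `H`. -/
def twistedEval {H : Type*} [Group H] {m : ℕ} (Ω : Subgroup (MulAut H)) (g : Fin m → H)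
    (w : List (H ⊕ (FreeGroup (Fin m) × Ω))) : H :=
  (w.map (Sum.elim id fun p => (p.2 : MulAut H) (FreeGroup.lift g p.1))).prod

/-- The solution language of a system of `Ω`-twisted equations with constraints. -/
def twistedSolutionLanguage {H : Type*} [Group H] {ι : Type*} (Ω : Subgroup (MulAut H))
    (η : H → List (ι × Bool)) {m : ℕ}
    (E : Set (List (H ⊕ (FreeGroup (Fin m) × Ω)))) (Rc : Fin m → Set H) :
    Language ((ι × Bool) ⊕ Unit) :=
  { w | ∃ g : Fin m → H, (∀ e ∈ E, twistedEval Ω g e = 1) ∧ (∀ i, g i ∈ Rc i) ∧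
      w = hashWord fun i => η (g i) }


/-- The standard normal form on `ℤᵏ` (written multiplicatively): the word
`a₁^{x₁} a₂^{x₂} ⋯ a_k^{x_k}` over the standard generators and their inverses. -/
def stdNF (k : ℕ) (x : Multiplicative (Fin k → ℤ)) : List (Fin k × Bool) :=
  (List.ofFn fun i : Fin k =>
    List.replicate ((Multiplicative.toAdd x) i).natAbs
      (i, decide (0 ≤ (Multiplicative.toAdd x) i))).flatten

/-- The standard generators of `ℤᵏ` (written multiplicatively). -/
def stdGen (k : ℕ) : Fin k → Multiplicative (Fin k → ℤ) :=
  fun i => Multiplicative.ofAdd (Pi.single i 1)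

/-! ### Expanding templates by semilinear exponent vectors -/

/-- Replace every variable `c` of a template by `ℓ c` repeated `v c` times. -/
def expand {α N : Type*} (ℓ : N → α) (v : N → ℕ) (w : List (α ⊕ N)) : List α :=
  w.flatMap (Sum.elim (fun a => [a]) fun c => List.replicate (v c) (ℓ c))

theorem subApply_eq_flatMap {C : Type*} (f : C → List C) (w : List C) :
    subApply f w = w.flatMap f := by
  simp [subApply, List.flatMap_def]

namespace TemplateSystem

variable {α J N : Type} (ℓ : J → N → α)

/-- A sentential form: each variable is marked by a nonterminal followed by its power. -/
def form (j : J) (v : N → ℕ) (w : List (α ⊕ N)) : List (α ⊕ Option (J × N)) :=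
  w.flatMap (Sum.elim (fun a => [Sum.inl a])
    fun c => Sum.inr (some (j, c)) :: List.replicate (v c) (Sum.inl (ℓ j c)))

/-- The substitutions: choose a template, add a period, or erase the nonterminals. -/
def table [DecidableEq J] (w : J → List (α ⊕ N)) (a : J → N → ℕ) (P : J → Finset (N → ℕ)) :
    (J ⊕ (Σ j, P j)) ⊕ Unit → α ⊕ Option (J × N) → List (α ⊕ Option (J × N))
  | _, Sum.inl x => [Sum.inl x]
  | Sum.inl (Sum.inl j), Sum.inr none => form ℓ j (a j) (w j)
  | _, Sum.inr none => [Sum.inr none]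
  | Sum.inl (Sum.inr p), Sum.inr (some (j, c)) =>
      Sum.inr (some (j, c)) ::
        List.replicate (if p.1 = j then p.2.1 c else 0) (Sum.inl (ℓ j c))
  | Sum.inl (Sum.inl _), Sum.inr (some x) => [Sum.inr (some x)]
  | Sum.inr _, Sum.inr (some _) => []

variable [DecidableEq J] (w : J → List (α ⊕ N)) (a : J → N → ℕ) (P : J → Finset (N → ℕ))

theorem subApply_map_inl (i : (J ⊕ (Σ j, P j)) ⊕ Unit) (u : List α) :
    subApply (table ℓ w a P i) (u.map Sum.inl) = u.map Sum.inl := by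
  rw [subApply_eq_flatMap]
  induction u with
  | nil => rfl
  | cons x u ih => rw [List.map_cons, List.flatMap_cons, ih]; cases i <;> simp [table]

theorem flatMap_replicate_inl (i : (J ⊕ (Σ j, P j)) ⊕ Unit) (n : ℕ) (x : α) :
    (List.replicate n (Sum.inl x)).flatMap (table ℓ w a P i) = List.replicate n (Sum.inl x) := by
  have := subApply_map_inl ℓ w a P i (List.replicate n x)
  rwa [subApply_eq_flatMap, List.map_replicate] at this

theorem subApply_choose_form (i j : J) (v : N → ℕ) (u : List (α ⊕ N)) :
    subApply (table ℓ w a P (Sum.inl (Sum.inl i))) (form ℓ j v u) = form ℓ j v u := by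
  rw [subApply_eq_flatMap, form, List.flatMap_assoc]
  congr 1
  funext x
  rcases x with x | c
  · simp [table]
  · simp [table, flatMap_replicate_inl]

theorem subApply_period_form (p : Σ j, P j) (j : J) (v : N → ℕ) (u : List (α ⊕ N)) :
    subApply (table ℓ w a P (Sum.inl (Sum.inr p))) (form ℓ j v u) =
      form ℓ j (v + if p.1 = j then p.2.1 else 0) u := by
  rw [subApply_eq_flatMap, form, form, List.flatMap_assoc]
  congr 1
  funext x
  rcases x with x | c
  · simp [table]
  · simp only [Sum.elim_inr, List.flatMap_cons, flatMap_replicate_inl]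
    split_ifs with h
    · simp [table, h, List.replicate_append_replicate, add_comm]
    · simp [table, h]

theorem subApply_erase_form (j : J) (v : N → ℕ) (u : List (α ⊕ N)) :
    subApply (table ℓ w a P (Sum.inr ())) (form ℓ j v u) =
      (expand (ℓ j) v u).map Sum.inl := by
  rw [subApply_eq_flatMap, form, expand, List.flatMap_assoc, List.map_flatMap]
  congr 1
  funext x
  rcases x with x | c
  · simp [table]
  · simp [table, flatMap_replicate_inl]

/-- The action of a word of substitutions on sentential forms. -/
def derive (x : List ((J ⊕ (Σ j, P j)) ⊕ Unit)) (u : List (α ⊕ Option (J × N))) :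
    List (α ⊕ Option (J × N)) :=
  x.foldl (fun v i => subApply (table ℓ w a P i) v) u

theorem derive_append (x y : List ((J ⊕ (Σ j, P j)) ⊕ Unit)) (u : List (α ⊕ Option (J × N))) :
    derive ℓ w a P (x ++ y) u = derive ℓ w a P y (derive ℓ w a P x u) := by
  simp [derive]

theorem exists_derive_form (j : J) (u : List (α ⊕ N)) (d : N → ℕ)
    (hd : d ∈ AddSubmonoid.closure (P j : Set (N → ℕ))) : ∀ v : N → ℕ,
    ∃ x, derive ℓ w a P x (form ℓ j v u) = form ℓ j (v + d) u := by
  induction hd using AddSubmonoid.closure_induction with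
  | mem p hp =>
    intro v
    refine ⟨[Sum.inl (Sum.inr ⟨j, p, hp⟩)], ?_⟩
    refine (subApply_period_form ℓ w a P ⟨j, p, hp⟩ j v u).trans ?_
    simp
  | zero => exact fun v => ⟨[], by simp [derive]⟩
  | add p q _ _ hp hq =>
    intro v
    obtain ⟨x, hx⟩ := hp v
    obtain ⟨y, hy⟩ := hq (v + p)
    exact ⟨x ++ y, by rw [derive_append, hx, hy, add_assoc]⟩

theorem derive_invariant (x : List ((J ⊕ (Σ j, P j)) ⊕ Unit)) :
    derive ℓ w a P x [Sum.inr none] = [Sum.inr none] ∨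
      ∃ j, ∃ d ∈ AddSubmonoid.closure (P j : Set (N → ℕ)),
        derive ℓ w a P x [Sum.inr none] = form ℓ j (a j + d) (w j) ∨
        derive ℓ w a P x [Sum.inr none] = (expand (ℓ j) (a j + d) (w j)).map Sum.inl := by
  induction x using List.reverseRecOn with
  | nil => exact Or.inl rfl
  | append_singleton x i ih =>
    rw [derive_append]
    generalize derive ℓ w a P x [Sum.inr none] = u at ih
    change subApply (table ℓ w a P i) u = _ ∨ ∃ j, ∃ d ∈ _,
      subApply (table ℓ w a P i) u = _ ∨ subApply (table ℓ w a P i) u = _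
    rcases ih with rfl | ⟨j, d, hd, rfl | rfl⟩
    · rcases i with (j | p) | _
      · exact Or.inr ⟨j, 0, zero_mem _, Or.inl (by simp [subApply, table])⟩
      · exact Or.inl (by simp [subApply, table])
      · exact Or.inl (by simp [subApply, table])
    · right
      rcases i with (i | p) | _
      · exact ⟨j, d, hd, Or.inl (subApply_choose_form ..)⟩
      · refine ⟨j, d + if p.1 = j then p.2.1 else 0, add_mem hd ?_, Or.inl ?_⟩
        · obtain ⟨i, p⟩ := p
          split_ifs with h
          · subst h
            exact AddSubmonoid.subset_closure p.2
          · exact zero_mem _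
        · rw [subApply_period_form, add_assoc]
      · exact ⟨j, d, hd, Or.inr (subApply_erase_form ..)⟩
    · exact Or.inr ⟨j, d, hd, Or.inr (subApply_map_inl ..)⟩

/-- The identification of the letters that are terminal. -/
def terminal {β : Type} : α ⊕ β → Option α := Sum.elim some fun _ => none

theorem map_terminal_eq_iff {β : Type} (x : List (α ⊕ β)) (u : List α) :
    x.map terminal = u.map some ↔ x = u.map Sum.inl := by
  constructor
  · intro h
    induction x generalizing u with
    | nil => cases u <;> simp_all
    | cons c x ih =>
      cases u with
      | nil => simp at h
      | cons b u =>
        rw [List.map_cons, List.map_cons, List.cons.injEq] at h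
        rw [List.map_cons, ← ih _ h.2]
        rcases c with c | c
        · rw [Option.some.inj h.1]
        · cases h.1
  · rintro rfl
    rw [List.map_map]
    rfl

/-- The EDT0L system generating all expansions of the templates `w j` by vectors in
`a j + ⟨P j⟩`. -/
def system [Fintype α] [Fintype J] [Fintype N] : EDT0LSystem α where
  C := α ⊕ Option (J × N)
  finC := inferInstance
  term := terminal
  term_inj := by
    rintro (c | c) (c' | c') b h h' <;> simp_all [terminal]
  start := [Sum.inr none]
  ι := (J ⊕ (Σ j, P j)) ⊕ Unit
  finι := inferInstance
  tab := table ℓ w a P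
  control := (Set.univ : Set (List _))
  control_reg := ⟨Unit, inferInstance, ⟨fun _ _ => (), (), Set.univ⟩, by
    ext x
    exact ⟨fun _ => trivial, fun _ => trivial⟩⟩

theorem accepts_system [Fintype α] [Fintype J] [Fintype N] : (system ℓ w a P).accepts =
    { u | ∃ j, ∃ d ∈ AddSubmonoid.closure (P j : Set (N → ℕ)),
      u = expand (ℓ j) (a j + d) (w j) } := by
  ext u
  constructor
  · rintro ⟨x, -, hx⟩
    replace hx : derive ℓ w a P x [Sum.inr none] = u.map Sum.inl :=
      (map_terminal_eq_iff _ _).1 hx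
    have inj : Function.Injective (List.map (Sum.inl : α → α ⊕ Option (J × N))) :=
      List.map_injective_iff.2 Sum.inl_injective
    rcases derive_invariant ℓ w a P x with h | ⟨j, d, hd, h | h⟩
    · rw [hx] at h
      rcases u with _ | ⟨b, u⟩
      · cases h
      · cases (List.cons.inj h).1
    · refine ⟨j, d, hd, inj ?_⟩
      rw [← subApply_erase_form ℓ w a P, ← h, hx, subApply_map_inl]
    · exact ⟨j, d, hd, inj (hx.symm.trans h)⟩
  · rintro ⟨j, d, hd, rfl⟩
    obtain ⟨x, hx⟩ := exists_derive_form ℓ w a P j (w j) d hd (a j)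
    refine ⟨([Sum.inl (Sum.inl j)] ++ x ++ [Sum.inr ()] : List ((J ⊕ (Σ j, P j)) ⊕ Unit)),
      trivial, (map_terminal_eq_iff _ _).2 ?_⟩
    change derive ℓ w a P _ [Sum.inr none] = _
    have h : derive ℓ w a P [Sum.inl (Sum.inl j)] [Sum.inr none] = form ℓ j (a j) (w j) := by
      simp [derive, subApply, table]
    rw [derive_append, derive_append, h, hx]
    exact subApply_erase_form ..

end TemplateSystem

open scoped Pointwise in
/-- Expansions of finitely many templates by exponent vectors taken from semilinear sets
form an EDT0L language. -/
theorem isEDT0L_expand {α J N : Type} [Finite α] [Finite J] [Finite N]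
    (ℓ : J → N → α) (w : J → List (α ⊕ N)) (S : J → Set (N → ℕ))
    (hS : ∀ j, IsSemilinearSet (S j)) :
    IsEDT0L ({ u | ∃ j, ∃ v ∈ S j, u = expand (ℓ j) v (w j) } : Language α) := by
  classical
  have := Fintype.ofFinite α
  have := Fintype.ofFinite N
  choose T hT hlin hST using hS
  have := fun j => (hT j).to_subtype
  have := Fintype.ofFinite (Σ j, T j)
  have hlin' : ∀ i : Σ j, T j, ∃ (a : N → ℕ) (P : Finset (N → ℕ)),
      (i.2 : Set (N → ℕ)) = a +ᵥ (AddSubmonoid.closure (P : Set (N → ℕ)) : Set (N → ℕ)) := by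
    intro i
    obtain ⟨a, P, hP, h⟩ := hlin i.1 i.2 i.2.2
    exact ⟨a, hP.toFinset, by simpa using h⟩
  choose a P hP using hlin'
  refine ⟨TemplateSystem.system (fun i c => ℓ i.1 c) (fun i => w i.1) a P, ?_⟩
  rw [TemplateSystem.accepts_system]
  ext u
  constructor
  · rintro ⟨i, d, hd, rfl⟩
    refine ⟨i.1, a i + d, ?_, rfl⟩
    rw [hST]
    refine ⟨i.2, i.2.2, ?_⟩
    rw [hP]
    exact Set.mem_vadd_set.2 ⟨d, hd, rfl⟩
  · rintro ⟨j, v, hv, rfl⟩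
    rw [hST] at hv
    obtain ⟨s, hs, hv⟩ := hv
    have hPs := hP ⟨j, s, hs⟩
    change s = _ at hPs
    rw [hPs] at hv
    obtain ⟨d, hd, rfl⟩ := Set.mem_vadd_set.1 hv
    exact ⟨⟨j, s, hs⟩, d, hd, rfl⟩

/-! ### Weighted automata over commutative monoids -/

section Automaton

variable {Q M : Type*} [AddCommMonoid M]

/-- `Via E S p q s`: there is a nonempty path from `p` to `q` with intermediate states in `S`
and weights from `E` adding up to `s`. -/
inductive Via (E : Q → Q → Set M) (S : Set Q) : Q → Q → M → Prop
  | edge {p q : Q} {e : M} : e ∈ E p q → Via E S p q e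
  | cons {p r q : Q} {e s : M} : e ∈ E p r → r ∈ S → Via E S r q s → Via E S p q (e + s)

variable {E : Q → Q → Set M} {S T : Set Q} {p q r : Q} {s s' d : M}

theorem Via.mono (h : Via E S p q s) (hST : S ⊆ T) : Via E T p q s := by
  induction h with
  | edge h => exact .edge h
  | cons h hr _ ih => exact .cons h (hST hr) ih

theorem Via.trans (h : Via E S p r s) (hr : r ∈ S) (h' : Via E S r q s') :
    Via E S p q (s + s') := by
  induction h with
  | edge h => exact .cons h hr h'
  | cons h ht _ ih => rw [add_assoc]; exact .cons h ht (ih hr h')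

theorem Via.closure_add (hr : r ∈ S) (hd : d ∈ AddSubmonoid.closure {s | Via E S r r s})
    (h : Via E S r q s) : Via E S r q (d + s) := by
  induction hd using AddSubmonoid.closure_induction generalizing s with
  | mem x hx => exact hx.trans hr h
  | zero => rwa [zero_add]
  | add x y _ _ hx hy => rw [add_assoc]; exact hx (hy h)

open scoped Pointwise in
theorem setOf_via_insert : {s | Via E (insert r S) p q s} = {s | Via E S p q s} ∪
    ({s | Via E S p r s} + (AddSubmonoid.closure {s | Via E S r r s} : Set M) +
      {s | Via E S r q s}) := by
  have hsub : S ⊆ insert r S := Set.subset_insert r S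
  ext s
  constructor
  · intro h
    induction h with
    | edge h => exact Or.inl (.edge h)
    | @cons p t q e s h ht _ ih =>
      simp only [Set.mem_union, Set.mem_add, Set.mem_ofPred_eq, SetLike.mem_coe] at ih ⊢
      rcases ht with rfl | ht
      · right
        rcases ih with ih | ⟨_, ⟨x, hx, c, hc, rfl⟩, z, hz, rfl⟩
        · exact ⟨e + 0, ⟨e, .edge h, 0, zero_mem _, rfl⟩, s, ih, by rw [add_zero]⟩
        · exact ⟨e + (x + c), ⟨e, .edge h, x + c,
            add_mem (AddSubmonoid.subset_closure hx) hc, rfl⟩, z, hz, by rw [add_assoc]⟩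
      · rcases ih with ih | ⟨_, ⟨x, hx, c, hc, rfl⟩, z, hz, rfl⟩
        · exact Or.inl (.cons h ht ih)
        · exact Or.inr ⟨e + x + c, ⟨e + x, .cons h ht hx, c, hc, rfl⟩, z, hz, by
            simp only [add_assoc]⟩
  · rintro (h | ⟨_, ⟨x, hx, c, hc, rfl⟩, z, hz, rfl⟩)
    · exact Via.mono h hsub
    · have hr : r ∈ insert r S := Set.mem_insert r S
      have hc' : c ∈ AddSubmonoid.closure {s | Via E (insert r S) r r s} :=
        AddSubmonoid.closure_mono (fun y hy => Via.mono hy hsub) hc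
      change Via _ _ _ _ (x + c + z)
      rw [add_assoc]
      exact (Via.mono hx hsub).trans hr (Via.closure_add hr hc' (Via.mono hz hsub))

theorem isSemilinearSet_via (hE : ∀ p q, IsSemilinearSet (E p q)) (hS : S.Finite) :
    ∀ p q, IsSemilinearSet {s | Via E S p q s} := by
  induction S, hS using Set.Finite.induction_on with
  | empty =>
    intro p q
    convert hE p q using 1
    ext s
    refine ⟨fun h => ?_, fun h => .edge h⟩
    cases h with
    | edge h => exact h
    | cons _ h => exact h.elim
  | insert _ _ ih =>
    intro p q
    rw [setOf_via_insert]
    exact (ih p q).union (((ih p _).add (ih _ _).closure).add (ih _ q))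

/-- The total weight of the run of an automaton on a word. -/
def runWeight {X : Type*} (step : Q → X → Q) (wt : Q → X → M) : Q → List X → M
  | _, [] => 0
  | p, x :: w => wt p x + runWeight step wt (step p x) w

theorem isSemilinearSet_runWeight {X : Type*} [Finite Q] [Finite X] (step : Q → X → Q)
    (wt : Q → X → M) (p q : Q) :
    IsSemilinearSet {s | ∃ w : List X, w.foldl step p = q ∧ runWeight step wt p w = s} := by
  let E : Q → Q → Set M := fun p q => {s | ∃ x, step p x = q ∧ wt p x = s}
  have hE : ∀ p q, IsSemilinearSet (E p q) := fun p q =>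
    .of_finite ((Set.finite_range (wt p)).subset (by rintro _ ⟨x, -, rfl⟩; exact ⟨x, rfl⟩))
  have key : {s | ∃ w : List X, w.foldl step p = q ∧ runWeight step wt p w = s} =
      {s | p = q ∧ s = 0} ∪ {s | Via E Set.univ p q s} := by
    ext s
    constructor
    · rintro ⟨w, hw, rfl⟩
      induction w generalizing p with
      | nil => exact Or.inl ⟨hw, rfl⟩
      | cons x w ih =>
        right
        have hx : wt p x ∈ E p (step p x) := ⟨x, rfl, rfl⟩
        rcases ih (step p x) hw with ⟨h, h0⟩ | h
        · change Via _ _ _ _ (_ + _)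
          rw [h0, add_zero]
          exact .edge (h ▸ hx)
        · exact .cons hx trivial h
    · rintro (⟨rfl, rfl⟩ | h)
      · exact ⟨[], rfl, rfl⟩
      · induction h with
        | edge h =>
          obtain ⟨x, rfl, rfl⟩ := h
          exact ⟨[x], rfl, by simp [runWeight]⟩
        | cons h _ _ ih =>
          obtain ⟨x, rfl, rfl⟩ := h
          obtain ⟨w, rfl, rfl⟩ := ih
          exact ⟨x :: w, rfl, rfl⟩
  rw [key]
  exact (IsSemilinearSet.of_finite ((Set.finite_singleton 0).subset fun s hs => hs.2)).union
    (isSemilinearSet_via hE Set.finite_univ p q)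

end Automaton

/-! ### Languages of chains and the standard normal form -/

theorem isRegular_isChain_getLast {α : Type} [Finite α] (R : α → α → Prop) (P : α → Prop) :
    Language.IsRegular ({w : List α | w.IsChain R ∧ ∃ a ∈ w.getLast?, P a} : Language α) := by
  classical
  have := Fintype.ofFinite α
  let D : DFA α (Option (Option α)) :=
    { step := fun q a => q.bind fun b => if ∀ c ∈ b, R c a then some (some a) else none
      start := some none
      accept := {q | ∃ a, q = some (some a) ∧ P a} }
  have hD : ∀ w, D.eval w = if w.IsChain R then some w.getLast? else none := by
    intro w
    induction w using List.reverseRecOn with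
    | nil => simp [D, DFA.eval]
    | append_singleton w a ih =>
      rw [DFA.eval_append_singleton, ih]
      by_cases h : w.IsChain R <;> simp [h, D, List.isChain_append]
  refine ⟨Option (Option α), inferInstance, D, ?_⟩
  ext w
  change (∃ a, D.eval w = some (some a) ∧ P a) ↔ w.IsChain R ∧ ∃ a ∈ w.getLast?, P a
  rw [hD]
  by_cases h : w.IsChain R <;> simp [h]

/-- The order in which letters may follow each other in standard normal forms. -/
def letterRel {k : ℕ} (x y : Fin k × Bool) : Prop := x.1 < y.1 ∨ x = y

theorem letterRel_trans {k : ℕ} {x y z : Fin k × Bool} (h : letterRel x y)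
    (h' : letterRel y z) : letterRel x z := by
  rcases h with h | rfl
  · rcases h' with h' | rfl
    · exact Or.inl (h.trans h')
    · exact Or.inl h
  · exact h'

theorem pairwise_stdNF (k : ℕ) (x : Multiplicative (Fin k → ℤ)) :
    (stdNF k x).Pairwise letterRel := by
  rw [stdNF, List.pairwise_flatten]
  constructor
  · intro l hl
    obtain ⟨i, rfl⟩ := (List.mem_ofFn' _ _).1 hl
    exact List.pairwise_replicate.2 (Or.inr (Or.inr rfl))
  · rw [List.pairwise_ofFn]
    intro i j hij a ha b hb
    rw [(List.mem_replicate.1 ha).2, (List.mem_replicate.1 hb).2]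
    exact Or.inl hij

theorem count_stdNF (k : ℕ) (x : Multiplicative (Fin k → ℤ)) (i : Fin k) (b : Bool) :
    (stdNF k x).count (i, b) =
      if decide (0 ≤ Multiplicative.toAdd x i) = b then (Multiplicative.toAdd x i).natAbs
      else 0 := by
  rw [stdNF, List.count_flatten, List.map_ofFn, List.sum_ofFn, Finset.sum_eq_single i]
  · simp [List.count_replicate]
  · intro j _ hj
    simp [List.count_replicate, hj]
  · simp

theorem exists_stdNF_eq (k : ℕ) {l : List (Fin k × Bool)} (hl : l.Pairwise letterRel) :
    ∃ x, stdNF k x = l := by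
  classical
  refine ⟨Multiplicative.ofAdd fun i => (l.count (i, true) : ℤ) - l.count (i, false), ?_⟩
  have hex : ∀ i, l.count (i, true) = 0 ∨ l.count (i, false) = 0 := by
    intro i
    by_contra! h
    have h1 := List.count_pos_iff.1 (Nat.pos_of_ne_zero h.1)
    have h2 := List.count_pos_iff.1 (Nat.pos_of_ne_zero h.2)
    have key : letterRel (i, true) (i, false) ∨ letterRel (i, false) (i, true) := by
      have : Std.Symm fun a b : Fin k × Bool => letterRel a b ∨ letterRel b a :=
        ⟨fun _ _ h => h.symm⟩
      exact (hl.imp Or.inl : l.Pairwise fun a b => letterRel a b ∨ letterRel b a).forall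
        h1 h2 (by simp)
    simp [letterRel] at key
  refine List.Perm.eq_of_pairwise ?_ (pairwise_stdNF k _) hl ?_
  · rintro a b - - (h | h) (h' | h')
    exacts [absurd h h'.asymm, h'.symm, h, h]
  · rw [List.perm_iff_count]
    rintro ⟨i, b⟩
    rw [count_stdNF]
    rcases hex i with h | h <;> cases b <;> (simp [h]; try omega)

theorem length_stdNF (k : ℕ) (x : Multiplicative (Fin k → ℤ)) :
    (stdNF k x).length = ∑ i, (Multiplicative.toAdd x i).natAbs := by
  simp [stdNF, List.length_flatten, List.map_ofFn, List.sum_ofFn, Function.comp_def]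

theorem evalWord_stdNF (k : ℕ) (x : Multiplicative (Fin k → ℤ)) :
    evalWord (stdGen k) (stdNF k x) = x := by
  rw [evalWord, stdNF, List.map_flatten, List.prod_flatten, List.map_ofFn, List.map_ofFn,
    List.prod_ofFn]
  apply Multiplicative.toAdd.injective
  funext j
  rw [toAdd_prod, Finset.sum_apply, Finset.sum_eq_single j]
  · rcases le_or_gt 0 (Multiplicative.toAdd x j) with h | h
    · simp [h, stdGen]
    · simp [not_le.2 h, stdGen, abs_of_neg h]
  · intro i _ hij
    by_cases h : 0 ≤ Multiplicative.toAdd x i <;> simp [h, stdGen, hij.symm]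
  · simp

/-! ### Coordinates with respect to a free abelian normal subgroup and a transversal -/

section Coordinates

variable {G : Type*} [Group G] {A : Subgroup G} {k : ℕ}
  (iso : Multiplicative (Fin k → ℤ) ≃* A) {rep : G → G}
  (hrep1 : ∀ g : G, g * (rep g)⁻¹ ∈ A) (hrep2 : ∀ g g' : G, g * g'⁻¹ ∈ A → rep g = rep g')

/-- The exponent vector of the component of `g` in `A`. -/
def coord (g : G) : Fin k → ℤ :=
  Multiplicative.toAdd (iso.symm ⟨g * (rep g)⁻¹, hrep1 g⟩)

/-- The element of `A` with a given exponent vector. -/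
def ofCoord (z : Fin k → ℤ) : G := iso (Multiplicative.ofAdd z)

theorem ofCoord_mem (z : Fin k → ℤ) : (ofCoord iso z : G) ∈ A :=
  (iso (Multiplicative.ofAdd z)).2

theorem ofCoord_injective : Function.Injective (ofCoord iso : (Fin k → ℤ) → G) :=
  Subtype.val_injective.comp (iso.injective.comp Multiplicative.ofAdd.injective)

theorem ofCoord_add (z z' : Fin k → ℤ) :
    (ofCoord iso (z + z') : G) = ofCoord iso z * ofCoord iso z' := by
  simp [ofCoord]

theorem ofCoord_coord (g : G) : ofCoord iso (coord iso hrep1 g) = g * (rep g)⁻¹ := by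
  simp [ofCoord, coord]

theorem ofCoord_coord_mul_rep (g : G) : ofCoord iso (coord iso hrep1 g) * rep g = g := by
  simp [ofCoord_coord]

include hrep2 in
theorem rep_mul_of_mem {a : G} (ha : a ∈ A) (g : G) : rep (a * g) = rep g :=
  hrep2 _ _ (by simpa using ha)

include iso hrep1 hrep2 in
theorem rep_mul (g x : G) : rep (g * x) = rep (rep g * x) := by
  conv_lhs => rw [← ofCoord_coord_mul_rep iso hrep1 g, mul_assoc]
  exact rep_mul_of_mem hrep2 (ofCoord_mem iso _) _

include hrep1 hrep2 in
theorem rep_ofCoord_mul (z : Fin k → ℤ) {t : G} (ht : t ∈ Set.range rep) :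
    rep (ofCoord iso z * t) = t := by
  obtain ⟨g, rfl⟩ := ht
  rw [rep_mul_of_mem hrep2 (ofCoord_mem iso z)]
  refine (hrep2 _ _ ?_).symm
  exact hrep1 g

include hrep2 in
theorem coord_ofCoord_mul (z : Fin k → ℤ) {t : G} (ht : t ∈ Set.range rep) :
    coord iso hrep1 (ofCoord iso z * t) = z := by
  apply ofCoord_injective iso
  rw [ofCoord_coord, rep_ofCoord_mul iso hrep1 hrep2 z ht, mul_inv_cancel_right]

include hrep2 in
theorem coord_mul (g x : G) :
    coord iso hrep1 (g * x) = coord iso hrep1 g + coord iso hrep1 (rep g * x) := by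
  apply ofCoord_injective iso
  rw [ofCoord_add, ofCoord_coord, ofCoord_coord, ofCoord_coord, rep_mul iso hrep1 hrep2 g x]
  group

include hrep2 in
theorem finite_range_rep [A.Normal] [A.FiniteIndex] : (Set.range rep).Finite := by
  refine (Set.finite_range fun q : G ⧸ A => rep q.out).subset ?_
  rintro _ ⟨g, rfl⟩
  obtain ⟨h, hh⟩ := QuotientGroup.mk_out_eq_mul A g
  refine ⟨(g : G ⧸ A), (hrep2 _ _ ?_).symm⟩
  rw [hh, mul_inv_rev, ← mul_assoc]
  exact Subgroup.Normal.conj_mem inferInstance _ (inv_mem h.2) g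

/-! ### Rational subsets -/

include hrep1 hrep2 in
theorem isSemilinearSet_of_isRationalSubset [Finite (Set.range rep)] {R : Set G}
    (hR : IsRationalSubset R) (t : Set.range rep) :
    IsSemilinearSet {z : Fin k → ℤ | ofCoord iso z * t ∈ R} := by
  obtain ⟨X, _, gen, L, -, ⟨σ, _, D, rfl⟩, rfl⟩ := hR
  let step : σ × Set.range rep → X → σ × Set.range rep :=
    fun q x => (D.step q.1 x, ⟨rep (q.2 * gen x), Set.mem_range_self _⟩)
  let wt : σ × Set.range rep → X → Fin k → ℤ := fun q x => coord iso hrep1 (q.2 * gen x)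
  let tr : σ → G → σ × Set.range rep := fun q g => (q, ⟨rep g, Set.mem_range_self g⟩)
  have hstep : ∀ (q : σ) (g : G) (x : X),
      step (tr q g) x = tr (D.step q x) (g * gen x) := by
    intro q g x
    simp only [step, tr, rep_mul iso hrep1 hrep2 g (gen x)]
  have hrun : ∀ (w : List X) (q : σ) (g : G),
      w.foldl step (tr q g) = tr (D.evalFrom q w) (g * (w.map gen).prod) ∧
      coord iso hrep1 g + runWeight step wt (tr q g) w =
        coord iso hrep1 (g * (w.map gen).prod) := by
    intro w
    induction w with
    | nil => simp [runWeight]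
    | cons x w ih =>
      intro q g
      obtain ⟨h1, h2⟩ := ih (D.step q x) (g * gen x)
      rw [List.foldl_cons, runWeight, hstep, h1, DFA.evalFrom_cons, List.map_cons,
        List.prod_cons, ← mul_assoc, ← h2, coord_mul iso hrep1 hrep2 g (gen x), ← add_assoc]
      exact ⟨rfl, rfl⟩
  have key : {z : Fin k → ℤ | ofCoord iso z * t ∈
      (fun w : List X => (w.map gen).prod) '' D.accepts} =
      ⋃ q : D.accept, (fun s => coord iso hrep1 1 + s) ''
        {s | ∃ w : List X, w.foldl step (tr D.start 1) = (q.1, t) ∧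
          runWeight step wt (tr D.start 1) w = s} := by
    ext z
    simp only [Set.mem_iUnion]
    constructor
    · rintro ⟨w, hw, hz⟩
      obtain ⟨h1, h2⟩ := hrun w D.start 1
      rw [one_mul] at h1 h2
      refine ⟨⟨D.eval w, hw⟩, _, ⟨w, ?_, rfl⟩, ?_⟩
      · rw [h1]
        refine Prod.ext rfl (Subtype.ext ?_)
        change rep _ = _
        rw [show (w.map gen).prod = _ from hz, rep_ofCoord_mul iso hrep1 hrep2 z t.2]
      · change _ + _ = z
        rw [h2, show (w.map gen).prod = _ from hz, coord_ofCoord_mul iso hrep1 hrep2 z t.2]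
    · rintro ⟨q, _, ⟨w, hw, rfl⟩, rfl⟩
      obtain ⟨h1, h2⟩ := hrun w D.start 1
      rw [one_mul] at h1 h2
      rw [h1] at hw
      refine ⟨w, ?_, ?_⟩
      · have : D.eval w = q := congrArg Prod.fst hw
        change D.eval w ∈ D.accept
        rw [this]
        exact q.2
      · have ht : rep (w.map gen).prod = t := congrArg (fun p => (p.2 : G)) hw
        change (w.map gen).prod = ofCoord iso (_ + _) * _
        rw [h2, ← ht, ofCoord_coord_mul_rep]
  rw [key]
  refine .iUnion fun q => ?_
  have := (isSemilinearSet_runWeight step wt (tr D.start 1) (q.1, t)).vadd (coord iso hrep1 1)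
  exact this

/-! ### Equations -/

theorem exists_lift_eq [A.Normal] {m : ℕ} (t : Fin m → G)
    (e : Monoid.Coprod G (FreeGroup (Fin m))) :
    ∃ (f : (Fin m → Fin k → ℤ) →+ (Fin k → ℤ)) (c : G), ∀ z : Fin m → Fin k → ℤ,
      Monoid.Coprod.lift (MonoidHom.id G) (FreeGroup.lift fun i => ofCoord iso (z i) * t i) e =
        ofCoord iso (f z) * c := by
  let conj : G → (Fin k → ℤ) →+ (Fin k → ℤ) := fun c => MonoidHom.toAdditive
    ((iso.symm : A →* Multiplicative (Fin k → ℤ)).comp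
      ((MulAut.conjNormal c : A ≃* A).toMonoidHom.comp (iso : Multiplicative (Fin k → ℤ) →* A)))
  have hconj : ∀ c z, ofCoord iso (conj c z) = c * ofCoord iso z * c⁻¹ := by
    intro c z
    change ((iso (iso.symm (MulAut.conjNormal c (iso (Multiplicative.ofAdd z)))) : A) : G) = _
    rw [MulEquiv.apply_symm_apply, MulAut.conjNormal_apply]
    rfl
  have mul : ∀ {x y : (Fin m → Fin k → ℤ) → G},
      (∃ (f : (Fin m → Fin k → ℤ) →+ (Fin k → ℤ)) (c : G), ∀ z, x z = ofCoord iso (f z) * c) →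
      (∃ (f : (Fin m → Fin k → ℤ) →+ (Fin k → ℤ)) (c : G), ∀ z, y z = ofCoord iso (f z) * c) →
      ∃ (f : (Fin m → Fin k → ℤ) →+ (Fin k → ℤ)) (c : G),
        ∀ z, x z * y z = ofCoord iso (f z) * c := by
    rintro x y ⟨f, c, hf⟩ ⟨f', c', hf'⟩
    refine ⟨f + (conj c).comp f', c * c', fun z => ?_⟩
    rw [hf, hf', AddMonoidHom.add_apply, AddMonoidHom.comp_apply, ofCoord_add, hconj]
    group
  have ofCoord_zero : (ofCoord iso 0 : G) = 1 := by simp [ofCoord]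
  have ofCoord_neg : ∀ z, (ofCoord iso (-z) : G) = (ofCoord iso z)⁻¹ := by simp [ofCoord]
  induction e using Monoid.Coprod.induction_on with
  | inl g => exact ⟨0, g, fun z => by simp [ofCoord_zero]⟩
  | inr u =>
    induction u using FreeGroup.induction_on with
    | C1 => exact ⟨0, 1, fun z => by simp [ofCoord_zero]⟩
    | of i => exact ⟨Pi.evalAddMonoidHom _ i, t i, fun z => by simp⟩
    | inv_of i _ =>
      refine ⟨-(conj (t i)⁻¹).comp (Pi.evalAddMonoidHom _ i), (t i)⁻¹, fun z => ?_⟩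
      simp [ofCoord_neg, hconj, mul_assoc]
    | mul u v hu hv => simpa only [map_mul] using mul hu hv
  | mul u v hu hv => simpa only [map_mul] using mul hu hv

theorem isSemilinearSet_solvesSystem [A.Normal] {m : ℕ} (t : Fin m → G)
    {E : Set (Monoid.Coprod G (FreeGroup (Fin m)))} (hE : E.Finite) :
    IsSemilinearSet {z : Fin m → Fin k → ℤ |
      SolvesSystem E fun i => ofCoord iso (z i) * t i} := by
  have key : {z : Fin m → Fin k → ℤ | SolvesSystem E fun i => ofCoord iso (z i) * t i} =
      ⋂ e ∈ E, {z | Monoid.Coprod.lift (MonoidHom.id G)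
        (FreeGroup.lift fun i => ofCoord iso (z i) * t i) e = 1} := by
    ext z
    simp [SolvesSystem]
  rw [key]
  refine .biInter hE fun e _ => ?_
  obtain ⟨f, c, hf⟩ := exists_lift_eq iso t e
  simp only [hf]
  by_cases hc : c⁻¹ ∈ A
  · convert (IsSemilinearSet.singleton (Multiplicative.toAdd (iso.symm ⟨c⁻¹, hc⟩))).preimage f
      using 1
    ext z
    have : ofCoord iso (Multiplicative.toAdd (iso.symm ⟨c⁻¹, hc⟩)) = c⁻¹ := by simp [ofCoord]
    change _ * c = 1 ↔ f z = _
    rw [mul_eq_one_iff_eq_inv, ← (ofCoord_injective iso).eq_iff, this]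
  · convert IsSemilinearSet.empty using 1
    refine Set.eq_empty_of_forall_notMem fun z hz => hc ?_
    rw [← mul_eq_one_iff_eq_inv.1 hz]
    exact ofCoord_mem iso _

end Coordinates

/-! ### Solution languages -/

theorem flatMap_intercalate {α β : Type*} (f : α → List β) (sep : List α)
    (L : List (List α)) :
    (sep.intercalate L).flatMap f = (sep.flatMap f).intercalate (L.map fun l => l.flatMap f) := by
  induction L with
  | nil => simp
  | cons l L ih =>
    cases L with
    | nil => simp
    | cons l' L =>
      rw [List.intercalate_cons_cons, List.flatMap_append, List.flatMap_append, ih]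
      simp [List.intercalate_cons_cons]

theorem flatMap_ofFn {α β : Type*} {n : ℕ} (f : α → List β) (g : Fin n → α) :
    (List.ofFn g).flatMap f = (List.ofFn fun i => f (g i)).flatten := by
  rw [List.flatMap_def, List.map_ofFn]
  rfl

/-- The vector of integers with given absolute values and signs. -/
def signed {ι κ : Type*} (s : ι × κ → Bool) : (ι × κ → ℕ) →+ (ι → κ → ℤ) where
  toFun v i j := if s (i, j) then v (i, j) else -v (i, j)
  map_zero' := by funext i j; simp
  map_add' v v' := by
    funext i j
    by_cases h : s (i, j) <;> simp [h, add_comm]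

theorem exists_signed_eq {ι κ : Type*} (z : ι → κ → ℤ) : ∃ s v, signed s v = z := by
  refine ⟨fun p => decide (0 ≤ z p.1 p.2), fun p => (z p.1 p.2).natAbs, ?_⟩
  funext i j
  by_cases h : 0 ≤ z i j
  · simp [signed, h]
  · simp [signed, h, abs_of_neg (not_le.1 h)]

section SolutionLanguage

variable {T : Type*} {m k : ℕ}

/-- The template `X₁₁⋯X₁ₖ t₁ # ⋯ # Xₘ₁⋯Xₘₖ tₘ`. -/
def solutionTemplate (t : Fin m → T) :
    List ((((Fin k ⊕ T) × Bool) ⊕ Unit) ⊕ Fin m × Fin k) :=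
  List.intercalate [Sum.inl (Sum.inr ())] (List.ofFn fun i =>
    (List.ofFn fun j => Sum.inr (i, j)) ++ [Sum.inl (Sum.inl (Sum.inr (t i), true))])

theorem expand_solutionTemplate (t : Fin m → T) (s : Fin m × Fin k → Bool)
    (v : Fin m × Fin k → ℕ) :
    expand (fun c : Fin m × Fin k =>
        (Sum.inl (Sum.inl c.2, s c) : ((Fin k ⊕ T) × Bool) ⊕ Unit)) v (solutionTemplate t) =
      hashWord fun i => (stdNF k (Multiplicative.ofAdd (signed s v i))).map
        (fun l => ((Sum.inl l.1 : Fin k ⊕ T), l.2)) ++ [(Sum.inr (t i), true)] := by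
  rw [expand, solutionTemplate, flatMap_intercalate, hashWord, List.map_ofFn]
  congr 2
  funext i
  simp only [Function.comp_apply, List.flatMap_append, flatMap_ofFn, List.map_append, stdNF,
    List.map_flatten, List.map_ofFn]
  congr 3
  funext j
  by_cases h : s (i, j)
  · simp [signed, h]
  · simp [signed, h]
    exact em _

end SolutionLanguage

/-! ### The inherited normal form -/

section InheritedNormalForm

variable {G : Type} [Group G] {A : Subgroup G} {k : ℕ}
  (iso : Multiplicative (Fin k → ℤ) ≃* A) {rep : G → G}
  (hrep1 : ∀ g : G, g * (rep g)⁻¹ ∈ A) (hrep2 : ∀ g g' : G, g * g'⁻¹ ∈ A → rep g = rep g')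
  {η : G → List ((Fin k ⊕ ↥(Set.range rep)) × Bool)}
  (hη : ∀ g, η g = (stdNF k (Multiplicative.ofAdd (coord iso hrep1 g))).map
    (fun l => (Sum.inl l.1, l.2)) ++ [(Sum.inr ⟨rep g, Set.mem_range_self g⟩, true)])

include hη

theorem evalWord_inherited (g : G) :
    evalWord (Sum.elim (fun i : Fin k => ((iso (stdGen k i) : A) : G))
      (fun t : Set.range rep => (t : G))) (η g) = g := by
  conv_rhs => rw [← ofCoord_coord_mul_rep iso hrep1 g]
  rw [hη, evalWord, List.map_append, List.prod_append, List.map_map]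
  congr 1
  · rw [ofCoord, ← evalWord_stdNF k (Multiplicative.ofAdd (coord iso hrep1 g)), evalWord]
    change _ = (A.subtype.comp iso.toMonoidHom) _
    rw [map_list_prod, List.map_map, ← evalWord, evalWord_stdNF]
    congr 2
    funext l
    by_cases h : l.2 <;> simp [h]
  · simp

include hrep2

theorem inherited_ofCoord_mul (z : Fin k → ℤ) (t : Set.range rep) :
    η (ofCoord iso z * t) = (stdNF k (Multiplicative.ofAdd z)).map
      (fun l => (Sum.inl l.1, l.2)) ++ [(Sum.inr t, true)] := by
  rw [hη, coord_ofCoord_mul iso hrep1 hrep2 z t.2]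
  simp only [rep_ofCoord_mul iso hrep1 hrep2 z t.2]

variable [Finite (Set.range rep)]

theorem isEDT0L_solutionLanguageC [A.Normal] {m : ℕ}
    {E : Set (Monoid.Coprod G (FreeGroup (Fin m)))} {Rc : Fin m → Set G} (hE : E.Finite)
    (hRc : ∀ i, IsRationalSubset (Rc i)) : IsEDT0L (solutionLanguageC η E Rc) := by
  let Sol : (Fin m → Set.range rep) → Set (Fin m → Fin k → ℤ) := fun t =>
    {z | SolvesSystem E fun i => ofCoord iso (z i) * t i} ∩
      ⋂ i, (Pi.evalAddMonoidHom (fun _ => Fin k → ℤ) i) ⁻¹' {z | ofCoord iso z * t i ∈ Rc i}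
  have hSol : ∀ t, IsSemilinearSet (Sol t) := fun t =>
    (isSemilinearSet_solvesSystem iso (fun i => (t i : G)) hE).inter <| .iInter fun i =>
      (isSemilinearSet_of_isRationalSubset iso hrep1 hrep2 (hRc i) (t i)).preimage _
  have hw : ∀ (t : Fin m → Set.range rep) (s : Fin m × Fin k → Bool) (v : Fin m × Fin k → ℕ),
      expand (fun c => Sum.inl (Sum.inl c.2, s c)) v (solutionTemplate t) =
        hashWord fun i => η (ofCoord iso (signed s v i) * t i) := by
    intro t s v
    rw [expand_solutionTemplate]
    simp only [inherited_ofCoord_mul iso hrep1 hrep2 hη]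
  refine (congrArg IsEDT0L ?_).mpr <| isEDT0L_expand
    (J := (Fin m → Set.range rep) × (Fin m × Fin k → Bool))
    (fun p c => Sum.inl (Sum.inl c.2, p.2 c)) (fun p => solutionTemplate p.1)
    (fun p => signed p.2 ⁻¹' Sol p.1) (fun p => (hSol p.1).preimage _)
  refine Set.ext fun u => ?_
  constructor
  · rintro ⟨g, hg, hgR, rfl⟩
    obtain ⟨s, v, hv⟩ := exists_signed_eq fun i => coord iso hrep1 (g i)
    have hgi : ∀ i, ofCoord iso (signed s v i) * rep (g i) = g i := by
      intro i
      rw [hv, ofCoord_coord_mul_rep]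
    refine ⟨(fun i => ⟨rep (g i), Set.mem_range_self _⟩, s), v, ⟨?_, ?_⟩, ?_⟩
    · change SolvesSystem E fun i => ofCoord iso (signed s v i) * rep (g i)
      simpa only [hgi] using hg
    · refine Set.mem_iInter.2 fun i => ?_
      change ofCoord iso (signed s v i) * rep (g i) ∈ Rc i
      rw [hgi]
      exact hgR i
    · rw [hw]
      simp only [hgi]
  · rintro ⟨⟨t, s⟩, v, ⟨h1, h2⟩, rfl⟩
    exact ⟨fun i => ofCoord iso (signed s v i) * t i, h1, fun i => Set.mem_iInter.1 h2 i, hw t s v⟩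

theorem isRegularNF_inherited : IsRegularNF η := by
  let R : (Fin k ⊕ Set.range rep) × Bool → (Fin k ⊕ Set.range rep) × Bool → Prop
    | (Sum.inl i, b), (Sum.inl j, c) => letterRel (i, b) (j, c)
    | (Sum.inl _, _), (Sum.inr _, _) => True
    | (Sum.inr _, _), _ => False
  let P : (Fin k ⊕ Set.range rep) × Bool → Prop := fun a => ∃ t, a = (Sum.inr t, true)
  let inc : Fin k × Bool → (Fin k ⊕ Set.range rep) × Bool := fun l => (Sum.inl l.1, l.2)
  have hchain : ∀ (l : List (Fin k × Bool)) (t : Set.range rep),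
      (l.map inc ++ [(Sum.inr t, true)]).IsChain R ↔ l.IsChain letterRel := by
    intro l t
    rw [List.isChain_append, List.isChain_map]
    refine ⟨fun h => h.1, fun h => ⟨h, List.isChain_singleton _, ?_⟩⟩
    intro x hx y hy
    rw [List.getLast?_map] at hx
    obtain ⟨x, -, rfl⟩ := Option.map_eq_some_iff.1 hx
    obtain rfl : (Sum.inr t, true) = y := by simpa using hy
    trivial
  have hform : ∀ (w : List ((Fin k ⊕ Set.range rep) × Bool)) (t : Set.range rep),
      (w ++ [(Sum.inr t, true)]).IsChain R → ∃ l : List (Fin k × Bool), w = l.map inc := by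
    intro w t h
    induction w with
    | nil => exact ⟨[], rfl⟩
    | cons a w ih =>
      obtain ⟨l, rfl⟩ := ih h.tail
      rcases a with ⟨i | t', b⟩
      · exact ⟨(i, b) :: l, rfl⟩
      · cases l <;> simp [R, inc] at h
  have trans : IsTrans (Fin k × Bool) letterRel := ⟨fun _ _ _ => letterRel_trans⟩
  refine (congrArg Language.IsRegular ?_).mpr <| isRegular_isChain_getLast R P
  refine Set.ext fun w => ?_
  constructor
  · rintro ⟨g, rfl⟩
    rw [hη]
    exact ⟨(hchain _ _).2 (pairwise_stdNF k _).isChain, _, List.getLast?_concat, _, rfl⟩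
  · rintro ⟨hw, a, ha, t, rfl⟩
    obtain ⟨w, rfl⟩ := List.getLast?_eq_some_iff.1 ha
    obtain ⟨l, rfl⟩ := hform w t hw
    obtain ⟨x, rfl⟩ := exists_stdNF_eq k (List.isChain_iff_pairwise.1 ((hchain l t).1 hw))
    exact ⟨_, inherited_ofCoord_mul iso hrep1 hrep2 hη (Multiplicative.toAdd x) t⟩

theorem isQuasigeodesicNF_inherited :
    IsQuasigeodesicNF (Sum.elim (fun i : Fin k => ((iso (stdGen k i) : A) : G))
      (fun t : Set.range rep => (t : G))) η := by
  set gen : Fin k ⊕ Set.range rep → G := Sum.elim _ _ with hgen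
  let letter : (Fin k ⊕ Set.range rep) × Bool → G :=
    fun l => if l.2 then gen l.1 else (gen l.1)⁻¹
  let norm : (Fin k → ℤ) → ℕ := fun z => ∑ i, (z i).natAbs
  have norm_add : ∀ z z', norm (z + z') ≤ norm z + norm z' := by
    intro z z'
    rw [← Finset.sum_add_distrib]
    exact Finset.sum_le_sum fun i _ => Int.natAbs_add_le _ _
  obtain ⟨B, hB⟩ := (Set.finite_range fun p : Set.range rep × (Fin k ⊕ Set.range rep) × Bool =>
    norm (coord iso hrep1 (p.1 * letter p.2))).bddAbove
  have hword : ∀ w : List ((Fin k ⊕ Set.range rep) × Bool),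
      norm (coord iso hrep1 (evalWord gen w)) ≤ norm (coord iso hrep1 1) + B * w.length := by
    intro w
    induction w using List.reverseRecOn with
    | nil => simp [evalWord]
    | append_singleton w l ih =>
      have : evalWord gen (w ++ [l]) = evalWord gen w * letter l := by
        simp [evalWord, letter]
      rw [this, coord_mul iso hrep1 hrep2, List.length_append, List.length_singleton, mul_add]
      have hl := hB ⟨(⟨_, Set.mem_range_self (evalWord gen w)⟩, l), rfl⟩
      refine (norm_add _ _).trans ?_
      dsimp only at hl
      omega
  refine ⟨(norm (coord iso hrep1 1) + B + 1 : ℕ), by positivity, fun g => ?_⟩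
  obtain ⟨w, hw, hlen⟩ := Nat.sInf_mem
    (s := {n | ∃ w : List ((Fin k ⊕ Set.range rep) × Bool), evalWord gen w = g ∧ w.length = n})
    ⟨_, η g, evalWord_inherited iso hrep1 hη g, rfl⟩
  have h := hword w
  rw [hw, hlen] at h
  change _ ≤ _ + B * wordLength gen g at h
  have hη' : (η g).length = norm (coord iso hrep1 g) + 1 := by
    rw [hη, List.length_append, List.length_map, length_stdNF]
    rfl
  rw [hη']
  have : norm (coord iso hrep1 g) + 1 ≤ (norm (coord iso hrep1 1) + B + 1) * wordLength gen g +
      (norm (coord iso hrep1 1) + B + 1) := by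
    nlinarith
  exact_mod_cast this

end InheritedNormalForm

/-- **Theorem B.** Let `G` be a finitely generated virtually abelian group
with finite index normal subgroup `A ≅ ℤᵏ`. Equip `A` with its standard generating set
and standard normal form (transported by the isomorphism), fix a right transversal
`T = range rep` of `A` in `G`, and let `η` be the inherited normal form
`η(g) = η_A(h_g)·t_g` over the generating set `{a₁,…,a_k} ⊔ T`. Then `η` is regular and
quasigeodesic, and the solution language w.r.t. `η` of any finite system of equations
with rational constraints in `G` is EDT0L. -/
theorem edt0l_virtually_abelian {G : Type} [Group G]
    (A : Subgroup G) [A.Normal] [A.FiniteIndex]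
    (k : ℕ) (iso : Multiplicative (Fin k → ℤ) ≃* A)
    (rep : G → G)
    (hrep1 : ∀ g : G, g * (rep g)⁻¹ ∈ A)
    (hrep2 : ∀ g g' : G, g * g'⁻¹ ∈ A → rep g = rep g')
    (η : G → List ((Fin k ⊕ ↥(Set.range rep)) × Bool))
    (hη : ∀ g : G, η g =
      ((stdNF k (iso.symm ⟨g * (rep g)⁻¹, hrep1 g⟩)).map fun l => (Sum.inl l.1, l.2)) ++
        [(Sum.inr ⟨rep g, Set.mem_range_self g⟩, true)]) :
    IsRegularNF η ∧
    IsQuasigeodesicNF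
      (Sum.elim (fun i : Fin k => ((iso (stdGen k i) : A) : G))
        (fun t : ↥(Set.range rep) => (t : G))) η ∧
    ∀ (m : ℕ) (E : Set (Monoid.Coprod G (FreeGroup (Fin m)))) (Rc : Fin m → Set G),
      E.Finite → (∀ i, IsRationalSubset (Rc i)) →
      IsEDT0L (solutionLanguageC η E Rc) := by
  have hcoord : ∀ g, η g = (stdNF k (Multiplicative.ofAdd (coord iso hrep1 g))).map
      (fun l => (Sum.inl l.1, l.2)) ++ [(Sum.inr ⟨rep g, Set.mem_range_self g⟩, true)] := hη
  have := (finite_range_rep hrep2).to_subtype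
  refine ⟨?_, ?_, fun m E Rc hE hRc => ?_⟩
  · exact isRegularNF_inherited iso hrep1 hrep2 hcoord
  · exact isQuasigeodesicNF_inherited iso hrep1 hrep2 hcoord
  · exact isEDT0L_solutionLanguageC iso hrep1 hrep2 hcoord hE hRc

end Paper
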